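/- Let ‖·‖ be a norm on ℝ^m, r > 1, Φ(μ) = ‖μ‖^r, r* = r/(r−1), Φ̄(μ) = (r·Φ(μ))^{1/r}, and Φ̄*(ν) = (r*·Φ*(ν))^{1/r*} where Φ* is the Legendre–Fenchel conjugate of Φ. Let e_1, …, e_m be the standard basis vectors of ℝ^m. Then for every μ ∈ ℝ^m: m^{−1/2}·(Σ_{i=1}^m Φ̄*(e_i)²)^{−1/2}·‖μ‖₂ ≤ Φ̄(μ) ≤ (Σ_{i=1}^m Φ̄(e_i)²)^{1/2}·‖μ‖₂, where ‖·‖₂ is the Euclidean norm. -/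

import Mathlib

open scoped InnerProductSpace

/-- The Legendre–Fenchel conjugate of a function on `ℝ^m`. -/
noncomputable def fenchelConj {m : ℕ} (Φ : EuclideanSpace ℝ (Fin m) → ℝ)
    (ν : EuclideanSpace ℝ (Fin m)) : ℝ :=
  ⨆ μ : EuclideanSpace ℝ (Fin m), (⟪ν, μ⟫_ℝ - Φ μ)

/-- `N` is a norm on `ℝ^m`. -/
def IsNorm {m : ℕ} (N : EuclideanSpace ℝ (Fin m) → ℝ) : Prop :=
  N 0 = 0 ∧ (∀ x, x ≠ 0 → 0 < N x) ∧
    (∀ (a : ℝ) (x), N (a • x) = |a| * N x) ∧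
    (∀ x y, N (x + y) ≤ N x + N y)

lemma IsNorm.nonneg' {m : ℕ} {N : EuclideanSpace ℝ (Fin m) → ℝ} (hN : IsNorm N) (x) : 0 ≤ N x := by
  by_cases hx : x = 0
  · rw [hx, hN.1]
  · exact (hN.2.1 x hx).le

lemma IsNorm.sum_le {m : ℕ} {N : EuclideanSpace ℝ (Fin m) → ℝ} (hN : IsNorm N)
    (s : Finset (Fin m)) (f : Fin m → EuclideanSpace ℝ (Fin m)) :
    N (∑ i ∈ s, f i) ≤ ∑ i ∈ s, N (f i) := by
  classical
  induction s using Finset.induction_on with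
  | empty => simp [hN.1]
  | insert a s ha ih =>
    rw [Finset.sum_insert ha, Finset.sum_insert ha]
    exact (hN.2.2.2 _ _).trans (by linarith)

lemma IsNorm.upper {m : ℕ} {N : EuclideanSpace ℝ (Fin m) → ℝ} (hN : IsNorm N)
    (μ : EuclideanSpace ℝ (Fin m)) :
    N μ ≤ √(∑ i : Fin m, N (EuclideanSpace.single i (1 : ℝ)) ^ 2) * ‖μ‖ := by
  have h1 : μ = ∑ i : Fin m, μ i • EuclideanSpace.single i (1 : ℝ) := by
    ext j
    simp [Finset.sum_apply, Pi.single_apply]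
  have h2 : N μ ≤ ∑ i : Fin m, N (EuclideanSpace.single i (1 : ℝ)) * |μ i| := by
    conv_lhs => rw [h1]
    refine (hN.sum_le _ _).trans (le_of_eq ?_)
    refine Finset.sum_congr rfl fun i _ => ?_
    rw [hN.2.2.1, mul_comm]
  refine h2.trans ((Real.sum_mul_le_sqrt_mul_sqrt _ _ _).trans (le_of_eq ?_))
  rw [EuclideanSpace.norm_eq]
  simp

lemma IsNorm.lower {m : ℕ} {N : EuclideanSpace ℝ (Fin m) → ℝ} (hN : IsNorm N) :
    ∃ c > 0, ∀ x, ‖x‖ ≤ c * N x := by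
  set C := √(∑ i : Fin m, N (EuclideanSpace.single i (1 : ℝ)) ^ 2) with hC
  have hcont : Continuous N := by
    have : LipschitzWith ⟨C, Real.sqrt_nonneg _⟩ N := by
      refine LipschitzWith.of_le_add_mul _ fun x y => ?_
      have h := hN.2.2.2 y (x - y)
      have h' := hN.upper (x - y)
      rw [add_sub_cancel] at h
      rw [dist_eq_norm]
      exact h.trans (by gcongr; exact h')
    exact this.continuous
  rcases (Metric.sphere (0 : EuclideanSpace ℝ (Fin m)) 1).eq_empty_or_nonempty with hS | hS
  · refine ⟨1, one_pos, fun x => ?_⟩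
    by_cases hx : x = 0
    · simp [hx, hN.1]
    · exfalso
      have : (‖x‖⁻¹ • x) ∈ Metric.sphere (0 : EuclideanSpace ℝ (Fin m)) 1 := by
        simp [norm_smul, hx]
      rw [hS] at this
      exact this
  · obtain ⟨x₀, hx₀, hmin⟩ := (isCompact_sphere (0 : EuclideanSpace ℝ (Fin m)) 1).exists_isMinOn hS
      hcont.continuousOn
    have hx₀0 : x₀ ≠ 0 := by
      rintro rfl
      simp at hx₀
    have hpos := hN.2.1 x₀ hx₀0
    refine ⟨(N x₀)⁻¹, inv_pos.2 hpos, fun x => ?_⟩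
    by_cases hx : x = 0
    · simp [hx, hN.1]
    · have hm : (‖x‖⁻¹ • x) ∈ Metric.sphere (0 : EuclideanSpace ℝ (Fin m)) 1 := by
        simp [norm_smul, hx]
      have h := hmin hm
      simp only [Set.mem_ofPred_eq] at h
      rw [hN.2.2.1, abs_of_nonneg (by positivity)] at h
      have hxp : 0 < ‖x‖ := norm_pos_iff.2 hx
      rw [inv_mul_eq_div, le_div_iff₀ hpos] 
      rw [inv_mul_eq_div, le_div_iff₀ hxp] at h
      linarith

lemma conj_bdd {m : ℕ} {N : EuclideanSpace ℝ (Fin m) → ℝ} (hN : IsNorm N)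
    {r q : ℝ} (h : r.HolderConjugate q) (ν : EuclideanSpace ℝ (Fin m)) :
    BddAbove (Set.range fun μ => ⟪ν, μ⟫_ℝ - N μ ^ r) := by
  obtain ⟨c, hc, hl⟩ := hN.lower
  refine ⟨(‖ν‖ * c) ^ q / q, ?_⟩
  rintro _ ⟨μ, rfl⟩
  have h1 := real_inner_le_norm ν μ
  have h2 : ‖ν‖ * ‖μ‖ ≤ ‖ν‖ * (c * N μ) := by gcongr; exact hl μ
  have h3 := Real.young_inequality_of_nonneg (hN.nonneg' μ)
    (show 0 ≤ ‖ν‖ * c by positivity) h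
  have h4 : N μ ^ r / r ≤ N μ ^ r := 
    div_le_self (Real.rpow_nonneg (hN.nonneg' μ) _) h.lt.le
  simp only
  nlinarith

lemma conj_pair {m : ℕ} {N : EuclideanSpace ℝ (Fin m) → ℝ} (hN : IsNorm N)
    {r q : ℝ} (h : r.HolderConjugate q) (ν μ : EuclideanSpace ℝ (Fin m)) :
    |⟪ν, μ⟫_ℝ| ≤ (q * fenchelConj (fun μ => N μ ^ r) ν) ^ (1 / q) * (r * N μ ^ r) ^ (1 / r) := by
  wlog ha : 0 ≤ ⟪ν, μ⟫_ℝ generalizing μ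
  · have := this (-μ) (by rw [inner_neg_right]; linarith)
    have hn : N (-μ) = N μ := by
      have := hN.2.2.1 (-1) μ
      simpa using this
    rwa [inner_neg_right, abs_neg, hn] at this
  rw [abs_of_nonneg ha]
  have hF : ∀ x, ⟪ν, x⟫_ℝ - N x ^ r ≤ fenchelConj (fun μ => N μ ^ r) ν :=
    fun x => le_ciSup (conj_bdd hN h ν) x
  set F := fenchelConj (fun μ => N μ ^ r) ν
  have hr := h.pos
  have hq := h.symm.pos
  have hF0 : 0 ≤ F := by
    have := hF 0
    simpa [hN.1, Real.zero_rpow hr.ne'] using this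
  by_cases hμ : μ = 0
  · subst hμ
    simp only [inner_zero_right]
    have := hN.nonneg' 0
    positivity
  have hNp := hN.2.1 μ hμ
  set b := (r * N μ ^ r) ^ (1 / r) with hb
  have hbp : 0 < b := by positivity
  have hbr : b ^ r = r * N μ ^ r := by
    rw [hb, ← Real.rpow_mul (by positivity), one_div, inv_mul_cancel₀ hr.ne', Real.rpow_one]
  set a := ⟪ν, μ⟫_ℝ
  set u := a / b with hu
  have hu0 : 0 ≤ u := by positivity
  rw [← div_le_iff₀ hbp, ← hu]
  have ht := hF ((u ^ (q - 1) / b) • μ)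
  rw [inner_smul_right, hN.2.2.1, abs_of_nonneg (by positivity),
    Real.mul_rpow (by positivity) hNp.le, Real.div_rpow (show 0 ≤ u ^ (q - 1) by positivity) hbp.le,
    ← Real.rpow_mul hu0, hbr] at ht
  have e1 : (q - 1) * r = q := by
    have := h.mul_eq_add
    linarith
  have e2 : u ^ (q - 1) / b * a = u ^ q := by
    have hq1 : q - 1 ≠ 0 := by have := h.symm.lt; linarith
    calc _ = u ^ (q-1) * u := by rw [hu]; ring
      _ = u ^ q := by
        rw [← Real.rpow_add_one' hu0 (by simpa using hq.ne')]; simp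
  have e3 : u ^ q / (r * N μ ^ r) * N μ ^ r = u ^ q / r := by
    have : 0 < N μ ^ r := by positivity
    field_simp
  change u ^ (q - 1) / b * a - _ ≤ F at ht
  rw [e1, e2, e3] at ht
  have e4 : u ^ q ≤ q * F := by
    have h5 := h.inv_add_inv_eq_one
    have h6 : u ^ q * q⁻¹ ≤ F := by
      have : q⁻¹ = 1 - r⁻¹ := by linarith
      rw [this]; 
      calc _ = u ^ q - u ^ q / r := by ring
        _ ≤ F := ht
    rw [← div_eq_mul_inv, div_le_iff₀ hq] at h6
    linarith
  calc u = (u ^ q) ^ (1 / q) := by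
        rw [← Real.rpow_mul hu0, mul_one_div_cancel hq.ne', Real.rpow_one]
    _ ≤ _ := by gcongr

theorem stmt3 {m : ℕ} (N : EuclideanSpace ℝ (Fin m) → ℝ) (hN : IsNorm N)
    (r : ℝ) (hr : 1 < r) (rstar : ℝ) (hrstar : rstar = r / (r - 1))
    (Φ : EuclideanSpace ℝ (Fin m) → ℝ) (hΦ : ∀ μ, Φ μ = N μ ^ r)
    (Φbar Φstarbar : EuclideanSpace ℝ (Fin m) → ℝ)
    (hΦbar : ∀ μ, Φbar μ = (r * Φ μ) ^ (1 / r))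
    (hΦstarbar : ∀ ν, Φstarbar ν = (rstar * fenchelConj Φ ν) ^ (1 / rstar))
    (e : Fin m → EuclideanSpace ℝ (Fin m))
    (he : ∀ i, e i = EuclideanSpace.single i (1 : ℝ)) :
    ∀ μ : EuclideanSpace ℝ (Fin m),
      (m : ℝ) ^ (-(1 / 2 : ℝ)) * (∑ i : Fin m, Φstarbar (e i) ^ 2) ^ (-(1 / 2 : ℝ)) * ‖μ‖
          ≤ Φbar μ ∧
      Φbar μ ≤ (∑ i : Fin m, Φbar (e i) ^ 2) ^ ((1 : ℝ) / 2) * ‖μ‖ := by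
  have h : r.HolderConjugate rstar := by
    rw [hrstar]; exact Real.HolderConjugate.conjExponent hr
  have hr0 := h.pos
  obtain rfl : Φ = fun μ => N μ ^ r := funext hΦ
  intro μ
  constructor
  · have hB : 0 ≤ Φbar μ := by
      rw [hΦbar]
      have := hN.nonneg' μ
      positivity
    set S := ∑ i : Fin m, Φstarbar (e i) ^ 2 with hS
    have hS0 : 0 ≤ S := Finset.sum_nonneg fun i _ => sq_nonneg _
    have key : ‖μ‖ ≤ √S * Φbar μ := by
      rw [EuclideanSpace.norm_eq, ← Real.sqrt_sq hB, ← Real.sqrt_mul hS0]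
      apply Real.sqrt_le_sqrt
      rw [hS, Finset.sum_mul]
      refine Finset.sum_le_sum fun i _ => ?_
      have := conj_pair hN h (e i) μ
      rw [← hΦbar, ← hΦstarbar] at this
      have h2 : ⟪e i, μ⟫_ℝ = μ i := by
        rw [he, EuclideanSpace.inner_single_left]; simp
      rw [h2] at this
      rw [← mul_pow, Real.norm_eq_abs]
      gcongr
    have hm1 : (m : ℝ) ^ (-(1 / 2 : ℝ)) ≤ 1 := by
      rcases Nat.eq_zero_or_pos m with hm | hm
      · rw [hm, Nat.cast_zero, Real.zero_rpow (by norm_num)]; norm_num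
      · exact Real.rpow_le_one_of_one_le_of_nonpos (by exact_mod_cast hm) (by norm_num)
    rcases hS0.eq_or_lt with h0 | h0
    · rw [← h0, Real.zero_rpow (by norm_num)]; simpa using hB
    · rw [Real.rpow_neg hS0, ← Real.sqrt_eq_rpow, mul_assoc]
      have hs : 0 < √S := Real.sqrt_pos.2 h0
      calc _ ≤ 1 * ((√S)⁻¹ * ‖μ‖) := by gcongr
        _ ≤ Φbar μ := by
          rw [one_mul, inv_mul_eq_div, div_le_iff₀ hs]; linarith
  · have hk : ∀ x, Φbar x = r ^ (1 / r) * N x := fun x => by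
      rw [hΦbar, Real.mul_rpow hr0.le (Real.rpow_nonneg (hN.nonneg' x) _),
        ← Real.rpow_mul (hN.nonneg' x), mul_one_div_cancel hr0.ne', Real.rpow_one]
    have hkp : 0 < r ^ (1 / r) := by positivity
    have hNb : IsNorm Φbar := by
      refine ⟨by simp [hk, hN.1], fun x hx => ?_, fun a x => ?_, fun x y => ?_⟩
      · rw [hk]; exact mul_pos hkp (hN.2.1 x hx)
      · rw [hk, hk, hN.2.2.1]; ring
      · rw [hk, hk, hk, ← mul_add]
        exact mul_le_mul_of_nonneg_left (hN.2.2.2 x y) hkp.le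
    rw [← Real.sqrt_eq_rpow]
    simp only [he]
    exact hNb.upper μ
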